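/- Uniqueness of classical solutions: if u and v are both classical solutions of the degenerately damped wave equation on [0,T] with the same initial data, i.e., u(0,x) = v(0,x) and ∂ₜu(0,x) = ∂ₜv(0,x) for all x ∈ [0,1], then u(t,x) = v(t,x) for all (t,x) ∈ [0,T] × [0,1]. -/

import Mathlib

open MeasureTheory Real Set

/-- The partial derivative in time of a function `u(t,x)`. -/
noncomputable def pdt (u : ℝ → ℝ → ℝ) : ℝ → ℝ → ℝ := fun t x => deriv (fun s => u s x) t

/-- The partial derivative in space of a function `u(t,x)`. -/
noncomputable def pdx (u : ℝ → ℝ → ℝ) : ℝ → ℝ → ℝ := fun t x => deriv (fun y => u t y) x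

/-- A classical (C²) solution of the degenerately damped wave equation
`∂ₜ²u - ∂ₓ²u + α u^(2m) ∂ₜu = 0` on `[0,T] × [0,1]` with homogeneous Dirichlet
boundary conditions. -/
def IsClassicalSolution (α : ℝ) (m : ℕ) (T : ℝ) (u : ℝ → ℝ → ℝ) : Prop :=
  ContDiff ℝ 2 (Function.uncurry u) ∧
  (∀ t ∈ Icc (0:ℝ) T, ∀ x ∈ Icc (0:ℝ) 1,
    pdt (pdt u) t x - pdx (pdx u) t x + α * (u t x) ^ (2*m) * pdt u t x = 0) ∧
  (∀ t ∈ Icc (0:ℝ) T, u t 0 = 0 ∧ u t 1 = 0)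

/-- The energy `E_u(t) = ½∫₀¹ (∂ₓu)² + ½∫₀¹ (∂ₜu)²`. -/
noncomputable def energy (u : ℝ → ℝ → ℝ) (t : ℝ) : ℝ :=
  (1/2) * (∫ x in (0:ℝ)..1, (pdx u t x)^2) + (1/2) * (∫ x in (0:ℝ)..1, (pdt u t x)^2)

section PartialDerivatives

variable {w : ℝ → ℝ → ℝ}

lemma hasDerivAt_pdt_fderiv (hw : Differentiable ℝ (Function.uncurry w)) (t x : ℝ) :
    HasDerivAt (fun s => w s x) (fderiv ℝ (Function.uncurry w) (t, x) (1, 0)) t :=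
  (hw (t, x)).hasFDerivAt.comp_hasDerivAt (f := fun s : ℝ => (s, x)) t
    ((hasDerivAt_id t).prodMk (hasDerivAt_const t x))

lemma hasDerivAt_pdx_fderiv (hw : Differentiable ℝ (Function.uncurry w)) (t x : ℝ) :
    HasDerivAt (fun y => w t y) (fderiv ℝ (Function.uncurry w) (t, x) (0, 1)) x :=
  (hw (t, x)).hasFDerivAt.comp_hasDerivAt (f := fun y : ℝ => (t, y)) x
    ((hasDerivAt_const x t).prodMk (hasDerivAt_id x))

lemma uncurry_pdt_eq_fderiv (hw : Differentiable ℝ (Function.uncurry w)) :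
    Function.uncurry (pdt w) = fun z => fderiv ℝ (Function.uncurry w) z (1, 0) :=
  funext fun z => (hasDerivAt_pdt_fderiv hw z.1 z.2).deriv

lemma uncurry_pdx_eq_fderiv (hw : Differentiable ℝ (Function.uncurry w)) :
    Function.uncurry (pdx w) = fun z => fderiv ℝ (Function.uncurry w) z (0, 1) :=
  funext fun z => (hasDerivAt_pdx_fderiv hw z.1 z.2).deriv

lemma hasDerivAt_pdt (hw : ContDiff ℝ 1 (Function.uncurry w)) (t x : ℝ) :
    HasDerivAt (fun s => w s x) (pdt w t x) t :=
  (hasDerivAt_pdt_fderiv (hw.differentiable one_ne_zero) t x).differentiableAt.hasDerivAt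

lemma hasDerivAt_pdx (hw : ContDiff ℝ 1 (Function.uncurry w)) (t x : ℝ) :
    HasDerivAt (fun y => w t y) (pdx w t x) x :=
  (hasDerivAt_pdx_fderiv (hw.differentiable one_ne_zero) t x).differentiableAt.hasDerivAt

lemma contDiff_pdt {n : WithTop ℕ∞} (hw : ContDiff ℝ (n + 1) (Function.uncurry w)) :
    ContDiff ℝ n (Function.uncurry (pdt w)) := by
  rw [uncurry_pdt_eq_fderiv (hw.differentiable (by simp))]
  exact (hw.fderiv_right le_rfl).clm_apply contDiff_const

lemma contDiff_pdx {n : WithTop ℕ∞} (hw : ContDiff ℝ (n + 1) (Function.uncurry w)) :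
    ContDiff ℝ n (Function.uncurry (pdx w)) := by
  rw [uncurry_pdx_eq_fderiv (hw.differentiable (by simp))]
  exact (hw.fderiv_right le_rfl).clm_apply contDiff_const

lemma pdx_pdt_eq_pdt_pdx (hw : ContDiff ℝ 2 (Function.uncurry w)) (t x : ℝ) :
    pdx (pdt w) t x = pdt (pdx w) t x := by
  have hw' : Differentiable ℝ (Function.uncurry w) := hw.differentiable two_ne_zero
  have hp : ContDiff ℝ 1 (Function.uncurry (pdt w)) := contDiff_pdt hw
  have hq : ContDiff ℝ 1 (Function.uncurry (pdx w)) := contDiff_pdx hw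
  have hd : DifferentiableAt ℝ (fderiv ℝ (Function.uncurry w)) (t, x) :=
    (hw.fderiv_right (m := 1) le_rfl).differentiable one_ne_zero _
  have hsymm : IsSymmSndFDerivAt ℝ (Function.uncurry w) (t, x) :=
    hw.contDiffAt.isSymmSndFDerivAt (by simp)
  have key (a b : ℝ × ℝ) : fderiv ℝ (fun z => fderiv ℝ (Function.uncurry w) z a) (t, x) b =
      fderiv ℝ (fderiv ℝ (Function.uncurry w)) (t, x) b a := by
    rw [(hd.hasFDerivAt.clm_apply (hasFDerivAt_const a _)).fderiv]
    simp
  rw [show pdx (pdt w) t x = _ from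
      (hasDerivAt_pdx_fderiv (hp.differentiable one_ne_zero) t x).deriv,
    show pdt (pdx w) t x = _ from
      (hasDerivAt_pdt_fderiv (hq.differentiable one_ne_zero) t x).deriv,
    uncurry_pdt_eq_fderiv hw', uncurry_pdx_eq_fderiv hw', key, key]
  exact hsymm _ _

lemma hasDerivAt_intervalIntegral_pdt (hw : ContDiff ℝ 1 (Function.uncurry w)) (a b t : ℝ) :
    HasDerivAt (fun s => ∫ x in a..b, w s x) (∫ x in a..b, pdt w t x) t := by
  have hp : Continuous (Function.uncurry (pdt w)) :=
    (contDiff_pdt (n := 0) (by simpa using hw)).continuous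
  obtain ⟨C, hC⟩ := ((isCompact_closedBall t 1).prod
    (isCompact_uIcc (a := a) (b := b))).exists_bound_of_continuousOn hp.continuousOn
  have hslice (s : ℝ) : Continuous (w s) := hw.continuous.comp (Continuous.prodMk_right s)
  refine (intervalIntegral.hasDerivAt_integral_of_dominated_loc_of_deriv_le
    (F := w) (F' := pdt w) (bound := fun _ => C)
    (Metric.closedBall_mem_nhds t one_pos) (.of_forall fun s => ?_) ?_ ?_
    (.of_forall fun x hx s hs => ?_) ?_ (.of_forall fun x _ s _ => ?_)).2
  · exact (hslice s).aestronglyMeasurable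
  · exact (hslice t).intervalIntegrable _ _
  · exact (hp.comp (Continuous.prodMk_right t)).aestronglyMeasurable
  · exact hC (s, x) ⟨hs, uIoc_subset_uIcc hx⟩
  · exact intervalIntegrable_const
  · exact hasDerivAt_pdt hw s x

end PartialDerivatives

lemma HasDerivAt.eq_zero_of_eqOn_Icc {f : ℝ → ℝ} {f' a b x : ℝ} (hab : a < b)
    (hf : ∀ y ∈ Icc a b, f y = 0) (hx : x ∈ Icc a b) (h : HasDerivAt f f' x) : f' = 0 :=
  (uniqueDiffOn_Icc hab x hx).eq_deriv _ h.hasDerivWithinAt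
    ((hasDerivWithinAt_const x _ (0 : ℝ)).congr hf (hf x hx))

/-- The energy augmented by the `L²` norm, so that it controls the function itself. -/
noncomputable def augmentedEnergyDensity (w : ℝ → ℝ → ℝ) (t x : ℝ) : ℝ :=
  pdt w t x ^ 2 + pdx w t x ^ 2 + w t x ^ 2

section Energy

variable {w : ℝ → ℝ → ℝ}

lemma contDiff_augmentedEnergyDensity (hw : ContDiff ℝ 2 (Function.uncurry w)) :
    ContDiff ℝ 1 (Function.uncurry (augmentedEnergyDensity w)) :=
  (((contDiff_pdt (n := 1) hw).pow 2).add ((contDiff_pdx (n := 1) hw).pow 2)).add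
    ((hw.of_le one_le_two).pow 2)

lemma pdt_augmentedEnergyDensity (hw : ContDiff ℝ 2 (Function.uncurry w)) (t x : ℝ) :
    pdt (augmentedEnergyDensity w) t x = 2 * (pdt w t x * pdt (pdt w) t x +
      pdx w t x * pdt (pdx w) t x + w t x * pdt w t x) := by
  refine HasDerivAt.deriv (((((hasDerivAt_pdt (contDiff_pdt (n := 1) hw) t x).pow 2).add
    ((hasDerivAt_pdt (contDiff_pdx (n := 1) hw) t x).pow 2)).add
    ((hasDerivAt_pdt (hw.of_le one_le_two) t x).pow 2)).congr_deriv ?_)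
  ring

/-- Integration by parts for the time derivative of the augmented energy. -/
lemma integral_pdt_augmentedEnergyDensity (hw : ContDiff ℝ 2 (Function.uncurry w)) {t : ℝ}
    (hp0 : pdt w t 0 = 0) (hp1 : pdt w t 1 = 0) :
    ∫ x in (0 : ℝ)..1, pdt (augmentedEnergyDensity w) t x =
      ∫ x in (0 : ℝ)..1, 2 * (pdt w t x * (pdt (pdt w) t x - pdx (pdx w) t x + w t x)) := by
  have hp : ContDiff ℝ 1 (Function.uncurry (pdt w)) := contDiff_pdt hw
  have hq : ContDiff ℝ 1 (Function.uncurry (pdx w)) := contDiff_pdx hw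
  have cont {f : ℝ → ℝ → ℝ} (hf : Continuous (Function.uncurry f)) : Continuous (f t) :=
    hf.comp (Continuous.prodMk_right t)
  have cw := cont hw.continuous
  have cp := cont hp.continuous
  have cq := cont hq.continuous
  have cpt := cont (contDiff_pdt (n := 0) (by simpa using hp)).continuous
  have cpx := cont (contDiff_pdx (n := 0) (by simpa using hp)).continuous
  have cqt := cont (contDiff_pdt (n := 0) (by simpa using hq)).continuous
  have cqx := cont (contDiff_pdx (n := 0) (by simpa using hq)).continuous
  have flux : ∫ x in (0 : ℝ)..1, (pdx (pdt w) t x * pdx w t x + pdt w t x * pdx (pdx w) t x) =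
      0 := by
    rw [intervalIntegral.integral_eq_sub_of_hasDerivAt
      (fun x _ => (hasDerivAt_pdx hp t x).mul (hasDerivAt_pdx hq t x))
      (((cpx.mul cq).add (cp.mul cqx)).intervalIntegrable _ _)]
    simp [hp0, hp1]
  simp only [pdt_augmentedEnergyDensity hw]
  rw [← sub_eq_zero, ← intervalIntegral.integral_sub
    (Continuous.intervalIntegrable (by fun_prop) _ _)
    (Continuous.intervalIntegrable (by fun_prop) _ _)]
  trans ∫ x in (0 : ℝ)..1, 2 * (pdx (pdt w) t x * pdx w t x + pdt w t x * pdx (pdx w) t x)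
  swap
  · rw [intervalIntegral.integral_const_mul, flux, mul_zero]
  refine intervalIntegral.integral_congr fun x _ => ?_
  simp only [pdx_pdt_eq_pdt_pdx hw]
  ring

/-- A `C²` function with zero initial data and Dirichlet boundary values vanishes as soon as its
d'Alembertian is bounded by a multiple of the function and its time derivative. -/
theorem eq_zero_of_abs_dAlembertian_le {T K : ℝ} (hT : 0 < T) (hK : 0 ≤ K)
    (hw : ContDiff ℝ 2 (Function.uncurry w))
    (hbound : ∀ t ∈ Icc (0 : ℝ) T, ∀ x ∈ Icc (0 : ℝ) 1,
      |pdt (pdt w) t x - pdx (pdx w) t x| ≤ K * (|pdt w t x| + |w t x|))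
    (hbd : ∀ t ∈ Icc (0 : ℝ) T, w t 0 = 0 ∧ w t 1 = 0)
    (h0 : ∀ x ∈ Icc (0 : ℝ) 1, w 0 x = 0) (h1 : ∀ x ∈ Icc (0 : ℝ) 1, pdt w 0 x = 0) :
    ∀ t ∈ Icc (0 : ℝ) T, ∀ x ∈ Icc (0 : ℝ) 1, w t x = 0 := by
  have hw1 : ContDiff ℝ 1 (Function.uncurry w) := hw.of_le one_le_two
  have he := contDiff_augmentedEnergyDensity hw
  have ce (t : ℝ) : Continuous (augmentedEnergyDensity w t) :=
    he.continuous.comp (Continuous.prodMk_right t)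
  have enonneg (t x : ℝ) : 0 ≤ augmentedEnergyDensity w t x := by
    unfold augmentedEnergyDensity
    positivity
  have hderiv := hasDerivAt_intervalIntegral_pdt he 0 1
  have hinit : ∫ x in (0 : ℝ)..1, augmentedEnergyDensity w 0 x = 0 := by
    refine intervalIntegral.integral_zero_ae (.of_forall fun x hx => ?_)
    replace hx := uIoc_subset_uIcc hx
    rw [uIcc_of_le zero_le_one] at hx
    have hq : pdx w 0 x = 0 :=
      (hasDerivAt_pdx hw1 0 x).eq_zero_of_eqOn_Icc zero_lt_one h0 hx
    simp [augmentedEnergyDensity, h0 x hx, h1 x hx, hq]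
  have hgrowth : ∀ t ∈ Ico (0 : ℝ) T,
      ‖∫ x in (0 : ℝ)..1, pdt (augmentedEnergyDensity w) t x‖ ≤
        (3 * K + 1) * ‖∫ x in (0 : ℝ)..1, augmentedEnergyDensity w t x‖ := by
    intro t ht
    have ht' := Ico_subset_Icc_self ht
    rw [integral_pdt_augmentedEnergyDensity hw
      ((hasDerivAt_pdt hw1 t 0).eq_zero_of_eqOn_Icc hT (fun s hs => (hbd s hs).1) ht')
      ((hasDerivAt_pdt hw1 t 1).eq_zero_of_eqOn_Icc hT (fun s hs => (hbd s hs).2) ht'),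
      Real.norm_of_nonneg
        (intervalIntegral.integral_nonneg zero_le_one fun x _ => enonneg t x),
      ← intervalIntegral.integral_const_mul]
    refine intervalIntegral.norm_integral_le_of_norm_le zero_le_one (.of_forall fun x hx => ?_)
      ((continuous_const.mul (ce t)).intervalIntegrable _ _)
    have hb := hbound t ht' x (Ioc_subset_Icc_self hx)
    rw [Real.norm_eq_abs, abs_mul, abs_mul, abs_two]
    have hsum : |pdt (pdt w) t x - pdx (pdx w) t x + w t x| ≤
        K * (|pdt w t x| + |w t x|) + |w t x| := (abs_add_le _ _).trans (by gcongr)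
    calc 2 * (|pdt w t x| * |pdt (pdt w) t x - pdx (pdx w) t x + w t x|)
        ≤ 2 * (|pdt w t x| * (K * (|pdt w t x| + |w t x|) + |w t x|)) := by gcongr
      _ ≤ (3 * K + 1) * (|pdt w t x| ^ 2 + |pdx w t x| ^ 2 + |w t x| ^ 2) := by
        nlinarith [mul_nonneg hK (sq_nonneg (|pdt w t x| - |w t x|)),
          sq_nonneg (|pdt w t x| - |w t x|), mul_nonneg hK (sq_nonneg |pdx w t x|),
          mul_nonneg hK (sq_nonneg |w t x|), sq_nonneg |pdx w t x|]
      _ = (3 * K + 1) * augmentedEnergyDensity w t x := by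
        simp only [augmentedEnergyDensity, sq_abs]
  have hzero := eq_zero_of_abs_deriv_le_mul_abs_self_of_eq_zero_right
    (fun t _ => (hderiv t).continuousAt.continuousWithinAt)
    (fun t _ => (hderiv t).hasDerivWithinAt) hinit hgrowth
  intro t ht x hx
  by_contra hne
  refine (intervalIntegral.integral_pos zero_lt_one (ce t).continuousOn
    (fun y _ => enonneg t y) ⟨x, hx, ?_⟩).ne' (hzero t ht)
  unfold augmentedEnergyDensity
  positivity

end Energy

/-- Uniqueness of classical solutions of the degenerately damped wave equation. -/
theorem uniqueness_of_classical_solutions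
    (α : ℝ) (hα : 0 < α) (m : ℕ) (hm : 1 ≤ m) (T : ℝ) (hT : 0 ≤ T)
    (u v : ℝ → ℝ → ℝ)
    (hu : IsClassicalSolution α m T u) (hv : IsClassicalSolution α m T v)
    (h0 : ∀ x ∈ Icc (0:ℝ) 1, u 0 x = v 0 x)
    (h1 : ∀ x ∈ Icc (0:ℝ) 1, pdt u 0 x = pdt v 0 x) :
    ∀ t ∈ Icc (0:ℝ) T, ∀ x ∈ Icc (0:ℝ) 1, u t x = v t x := by
  obtain ⟨cu, eu, bu⟩ := hu
  obtain ⟨cv, ev, bv⟩ := hv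
  rcases hT.eq_or_lt with rfl | hT
  · intro t ht x hx
    obtain rfl : t = 0 := le_antisymm ht.2 ht.1
    exact h0 x hx
  have cu1 : ContDiff ℝ 1 (Function.uncurry u) := cu.of_le one_le_two
  have cv1 : ContDiff ℝ 1 (Function.uncurry v) := cv.of_le one_le_two
  have cpu : ContDiff ℝ 1 (Function.uncurry (pdt u)) := contDiff_pdt cu
  have cpv : ContDiff ℝ 1 (Function.uncurry (pdt v)) := contDiff_pdt cv
  have cqu : ContDiff ℝ 1 (Function.uncurry (pdx u)) := contDiff_pdx cu
  have cqv : ContDiff ℝ 1 (Function.uncurry (pdx v)) := contDiff_pdx cv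
  set w : ℝ → ℝ → ℝ := fun t x => u t x - v t x with hwdef
  have hp : pdt w = fun t x => pdt u t x - pdt v t x := by
    ext t x
    exact ((hasDerivAt_pdt cu1 t x).sub (hasDerivAt_pdt cv1 t x)).deriv
  have hq : pdx w = fun t x => pdx u t x - pdx v t x := by
    ext t x
    exact ((hasDerivAt_pdx cu1 t x).sub (hasDerivAt_pdx cv1 t x)).deriv
  have hpp (t x : ℝ) : pdt (pdt w) t x = pdt (pdt u) t x - pdt (pdt v) t x := by
    rw [hp]
    exact ((hasDerivAt_pdt cpu t x).sub (hasDerivAt_pdt cpv t x)).deriv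
  have hqq (t x : ℝ) : pdx (pdx w) t x = pdx (pdx u) t x - pdx (pdx v) t x := by
    rw [hq]
    exact ((hasDerivAt_pdx cqu t x).sub (hasDerivAt_pdx cqv t x)).deriv
  -- The difference solves a linear equation whose coefficients are continuous.
  let A : ℝ × ℝ → ℝ := fun z => α * Function.uncurry u z ^ (2 * m)
  let B : ℝ × ℝ → ℝ := fun z => α * Function.uncurry (pdt v) z *
    ∑ i ∈ Finset.range (2 * m), Function.uncurry u z ^ i * Function.uncurry v z ^ (2 * m - 1 - i)
  have hA : Continuous A := continuous_const.mul (cu.continuous.pow _)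
  have hB : Continuous B := (continuous_const.mul cpv.continuous).mul
    (continuous_finsetSum _ fun i _ => (cu.continuous.pow _).mul (cv.continuous.pow _))
  have hcompact : IsCompact (Icc (0 : ℝ) T ×ˢ Icc (0 : ℝ) 1) := isCompact_Icc.prod isCompact_Icc
  obtain ⟨a, ha⟩ := hcompact.exists_bound_of_continuousOn hA.continuousOn
  obtain ⟨b, hb⟩ := hcompact.exists_bound_of_continuousOn hB.continuousOn
  have hlinear : ∀ t ∈ Icc (0 : ℝ) T, ∀ x ∈ Icc (0 : ℝ) 1,
      pdt (pdt w) t x - pdx (pdx w) t x = -(A (t, x) * pdt w t x + B (t, x) * w t x) := by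
    intro t ht x hx
    have hgeom : (∑ i ∈ Finset.range (2 * m), u t x ^ i * v t x ^ (2 * m - 1 - i)) *
        (u t x - v t x) = u t x ^ (2 * m) - v t x ^ (2 * m) :=
      (Commute.all _ _).geom_sum₂_mul _
    rw [hpp, hqq, hp]
    simp only [hwdef, A, B, Function.uncurry_apply_pair]
    linear_combination eu t ht x hx - ev t ht x hx + α * pdt v t x * hgeom
  have hzero := eq_zero_of_abs_dAlembertian_le (w := w) (K := max (max a b) 0) hT
    (le_max_right _ _) (cu.sub cv) (fun t ht x hx => ?_)
    (fun t ht => by simp [hwdef, bu t ht, bv t ht]) (fun x hx => by simp [hwdef, h0 x hx])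
    (fun x hx => by simp [hp, h1 x hx])
  · exact fun t ht x hx => sub_eq_zero.1 (hzero t ht x hx)
  · rw [hlinear t ht x hx, abs_neg, mul_add]
    refine (abs_add_le _ _).trans ?_
    rw [abs_mul (A _), abs_mul (B _)]
    gcongr
    · exact (ha (t, x) ⟨ht, hx⟩).trans (le_max_of_le_left (le_max_left a b))
    · exact (hb (t, x) ⟨ht, hx⟩).trans (le_max_of_le_left (le_max_right a b))
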